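/- arXiv:1210.7434 — 2 statements merged into one kernel-verified Lean document; each statement's English description precedes it below -/
import Mathlib

section
/- Let c > 0 and x ∈ ℝ, and let h : ℝ → ℝ be continuously differentiable on (−∞, x] with both h and h′ integrable on (−∞, x]. For real k > 0 set k₁ = √(k² + c²) and φ₁(k) = exp(−ik₁x) + ∫_{−∞}^x h(y)·exp(−ik₁y) dy. Then as k → +∞, φ₁(k)·exp(ikx) = 1 + (c²x/2 − h(x))/(ik) + o(1/k); that is, k·(φ₁(k)e^{ikx} − 1 − (c²x/2 − h(x))/(ik)) → 0. -/
open Filter Topology MeasureTheory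

/-- Integration by parts on a left half-line against an oscillating exponential. -/
theorem integral_Iic_mul_exp_eq (x w : ℝ) (hw : w ≠ 0) (h h' : ℝ → ℝ)
    (hderiv : ∀ y ∈ Set.Iic x, HasDerivWithinAt h (h' y) (Set.Iic x) y)
    (hint : IntegrableOn h (Set.Iic x)) (hint' : IntegrableOn h' (Set.Iic x)) :
    ∫ y in Set.Iic x, (h y : ℂ) * Complex.exp (-(Complex.I * w * y)) =
      Complex.I / w * ((h x : ℂ) * Complex.exp (-(Complex.I * w * x))
        - ∫ y in Set.Iic x, (h' y : ℂ) * Complex.exp (-(Complex.I * w * y))) := by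
  have hwC : (w : ℂ) ≠ 0 := by exact_mod_cast hw
  have hd : ∀ y ∈ Set.Iio x, HasDerivAt h (h' y) y := fun y hy =>
    (hderiv y (Set.Iio_subset_Iic_self hy)).hasDerivAt (Iic_mem_nhds hy)
  have hnorm : ∀ y : ℝ, ‖Complex.exp (-(Complex.I * w * y))‖ = 1 := fun y => by
    simp [Complex.norm_exp]
  have hcexp : Continuous fun y : ℝ => Complex.exp (-(Complex.I * w * y)) := by fun_prop
  have hprod : ∀ g : ℝ → ℝ, IntegrableOn g (Set.Iic x) →
      IntegrableOn (fun y => (g y : ℂ) * Complex.exp (-(Complex.I * w * y))) (Set.Iic x) :=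
    fun g hg => hg.ofReal.mul_bdd hcexp.aestronglyMeasurable
      (ae_of_all _ fun y => (hnorm y).le)
  have hv : ∀ y ∈ Set.Iio x, HasDerivAt
      (fun y : ℝ => Complex.I / w * Complex.exp (-(Complex.I * w * y)))
      (Complex.exp (-(Complex.I * w * y))) y := fun y _ => by
    have h1 : HasDerivAt (fun y : ℝ => -(Complex.I * w * (y : ℂ))) (-(Complex.I * w)) y := by
      simpa [Pi.neg_def] using
        ((Complex.ofRealCLM.hasDerivAt (x := y)).const_mul (Complex.I * w)).neg
    refine (h1.cexp.const_mul (Complex.I / (w : ℂ))).congr_deriv ?_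
    field_simp
    simp
  have hzero : Tendsto h atBot (𝓝 0) :=
    tendsto_zero_of_hasDerivAt_of_integrableOn_Iic (a := x - 1)
      (fun y hy => hd y (lt_of_le_of_lt hy (sub_one_lt x)))
      (hint'.mono_set (Set.Iic_subset_Iic.2 (sub_one_lt x).le))
      (hint.mono_set (Set.Iic_subset_Iic.2 (sub_one_lt x).le))
  have hleft : ContinuousWithinAt h (Set.Iio x) x :=
    ((hderiv x Set.self_mem_Iic).continuousWithinAt).mono Set.Iio_subset_Iic_self
  have key := integral_Iic_mul_deriv_eq_deriv_mul (a := x)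
    (u := fun y => (h y : ℂ)) (u' := fun y => (h' y : ℂ))
    (v := fun y : ℝ => Complex.I / w * Complex.exp (-(Complex.I * w * y)))
    (v' := fun y : ℝ => Complex.exp (-(Complex.I * w * y)))
    (a' := (h x : ℂ) * (Complex.I / w * Complex.exp (-(Complex.I * w * x)))) (b' := 0)
    (fun y hy => (hd y hy).ofReal_comp) hv (hprod h hint)
    (((hprod h' hint').const_mul (Complex.I / (w : ℂ))).congr
      (ae_of_all _ fun y => by simp only [Pi.mul_apply]; ring))
    ?_ ?_
  · rw [key, mul_sub, ← integral_const_mul, sub_zero]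
    congr 1
    · ring
    · exact integral_congr_ae (ae_of_all _ fun y => by simp only; ring)
  · refine ((Complex.continuous_ofReal.tendsto _).comp hleft).mul ?_
    exact ((hcexp.const_mul _).tendsto x).mono_left nhdsWithin_le_nhds
  · rw [tendsto_zero_iff_norm_tendsto_zero]
    have := hzero.norm.mul_const ‖Complex.I / (w : ℂ)‖
    simp only [norm_zero, zero_mul] at this
    refine this.congr fun y => ?_
    simp only [Pi.mul_apply, norm_mul, hnorm, Complex.norm_real, mul_one]

/-- Riemann–Lebesgue lemma on a left half-line. -/
theorem tendsto_integral_Iic_mul_exp (x : ℝ) (g : ℝ → ℝ) :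
    Tendsto (fun w : ℝ => ∫ y in Set.Iic x, (g y : ℂ) * Complex.exp (-(Complex.I * w * y)))
      atTop (𝓝 0) := by
  have h1 := (Real.tendsto_integral_exp_smul_cocompact
    ((Set.Iic x).indicator fun y => (g y : ℂ))).comp
      ((tendsto_id.atTop_div_const Real.two_pi_pos).mono_right atTop_le_cocompact)
  refine h1.congr fun w => ?_
  rw [← integral_indicator measurableSet_Iic]
  refine integral_congr_ae (ae_of_all _ fun y => ?_)
  by_cases hy : y ∈ Set.Iic x
  · simp only [Set.indicator_of_mem hy, Circle.smul_def, Real.fourierChar_apply, smul_eq_mul, id]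
    rw [mul_comm]
    congr 2
    push_cast
    field_simp
  · simp [Set.indicator_of_notMem hy]

theorem tendsto_div_sqrt_sq_add_sq (c : ℝ) :
    Tendsto (fun k : ℝ => k / √(k ^ 2 + c ^ 2)) atTop (𝓝 1) := by
  have h1 : Tendsto (fun k : ℝ => (√(1 + (c / k) ^ 2))⁻¹) atTop (𝓝 1) := by
    have h2 : Tendsto (fun k : ℝ => c / k) atTop (𝓝 0) := tendsto_const_nhds.div_atTop tendsto_id
    simpa using (((h2.pow 2).const_add 1).sqrt).inv₀ (by simp)
  refine h1.congr' ?_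
  filter_upwards [eventually_gt_atTop 0] with k hk
  have h3 : k ^ 2 + c ^ 2 = k ^ 2 * (1 + (c / k) ^ 2) := by field_simp
  rw [h3, Real.sqrt_mul (sq_nonneg k), Real.sqrt_sq hk.le, div_mul_eq_div_div, div_self hk.ne',
    one_div]

theorem tendsto_mul_sqrt_sq_add_sq_sub (c : ℝ) :
    Tendsto (fun k : ℝ => k * (√(k ^ 2 + c ^ 2) - k)) atTop (𝓝 (c ^ 2 / 2)) := by
  have hr := tendsto_div_sqrt_sq_add_sq c
  have h1 := (hr.div (hr.const_add 1) (by norm_num)).const_mul (c ^ 2)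
  have h2 : c ^ 2 * (1 / (1 + 1)) = c ^ 2 / 2 := by ring
  rw [h2] at h1
  refine h1.congr' ?_
  filter_upwards [eventually_gt_atTop 0] with k hk
  have hs : 0 < √(k ^ 2 + c ^ 2) := Real.sqrt_pos.2 (by positivity)
  have hsq : √(k ^ 2 + c ^ 2) ^ 2 = k ^ 2 + c ^ 2 := Real.sq_sqrt (by positivity)
  simp only [Pi.div_apply]
  field_simp
  linear_combination -hsq

/-- If `k * d k → a` then `k * (exp (z * d k) - 1) → z * a`. -/
theorem tendsto_mul_exp_sub_one {d : ℝ → ℝ} {a : ℝ} (z : ℂ)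
    (hd : Tendsto (fun k => k * d k) atTop (𝓝 a)) (hd0 : Tendsto d atTop (𝓝 0)) :
    Tendsto (fun k : ℝ => (k : ℂ) * (Complex.exp (z * d k) - 1)) atTop (𝓝 (z * a)) := by
  have hc : ContinuousAt (dslope Complex.exp 0) 0 :=
    continuousAt_dslope_same.2 Complex.differentiableAt_exp
  have hz : Tendsto (fun k => z * (d k : ℂ)) atTop (𝓝 0) := by
    simpa using ((Complex.continuous_ofReal.tendsto 0).comp hd0).const_mul z
  have h1 := ((((Complex.continuous_ofReal.tendsto a).comp hd).const_mul z)).mul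
    (hc.tendsto.comp hz)
  have h2 : dslope Complex.exp 0 0 = 1 := by simp
  rw [h2, mul_one] at h1
  refine h1.congr fun k => ?_
  have h3 := sub_smul_dslope Complex.exp 0 (z * (d k : ℂ))
  simp only [sub_zero, smul_eq_mul, Complex.exp_zero] at h3
  simp only [Function.comp_apply, ← h3]
  push_cast
  ring

/-- Large-`k` expansion of the left Jost solution on the steplike background:
with `k₁ = √(k² + c²)` and
`φ₁(k) = e^{−ik₁x} + ∫_{−∞}^x h(y)e^{−ik₁y} dy`, one has
`φ₁(k)e^{ikx} = 1 + (c²x/2 − h(x))/(ik) + o(1/k)` as `k → +∞`. -/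
theorem stmt7 (c x : ℝ) (hc : 0 < c) (h h' : ℝ → ℝ)
    (hderiv : ∀ y ∈ Set.Iic x, HasDerivWithinAt h (h' y) (Set.Iic x) y)
    (hcont : ContinuousOn h' (Set.Iic x))
    (hint : IntegrableOn h (Set.Iic x))
    (hint' : IntegrableOn h' (Set.Iic x))
    (φ₁ : ℝ → ℂ)
    (hφ₁ : ∀ k : ℝ, φ₁ k =
      Complex.exp (-(Complex.I * (Real.sqrt (k ^ 2 + c ^ 2) : ℝ) * x))
        + ∫ y in Set.Iio x,
            (h y : ℂ) * Complex.exp (-(Complex.I * (Real.sqrt (k ^ 2 + c ^ 2) : ℝ) * y))) :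
    Tendsto (fun k : ℝ =>
      (k : ℂ) * (φ₁ k * Complex.exp (Complex.I * k * x) - 1
        - ((c ^ 2 * x / 2 - h x : ℝ) : ℂ) / (Complex.I * k))) atTop (nhds 0) := by
  have hr := tendsto_div_sqrt_sq_add_sq c
  have hkd := tendsto_mul_sqrt_sq_add_sq_sub c
  have hd0 : Tendsto (fun k : ℝ => √(k ^ 2 + c ^ 2) - k) atTop (𝓝 0) := by
    have h1 := hkd.mul tendsto_inv_atTop_zero
    rw [mul_zero] at h1
    refine h1.congr' ?_
    filter_upwards [eventually_gt_atTop 0] with k hk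
    field_simp
  have hs : Tendsto (fun k : ℝ => √(k ^ 2 + c ^ 2)) atTop atTop :=
    tendsto_atTop_mono (fun k : ℝ => Real.le_sqrt_of_sq_le (le_add_of_nonneg_right (sq_nonneg c)))
      tendsto_id
  have hJ := (tendsto_integral_Iic_mul_exp x h').comp hs
  have hE := tendsto_mul_exp_sub_one (-(Complex.I * x)) hkd hd0
  have hexp : Tendsto (fun k : ℝ => Complex.exp (-(Complex.I * x) * ↑(√(k ^ 2 + c ^ 2) - k)))
      atTop (𝓝 1) := by
    have h1 := (((Complex.continuous_ofReal.tendsto 0).comp hd0).const_mul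
      (-(Complex.I * (x : ℂ)))).cexp
    simpa using h1
  have hJe : Tendsto (fun k : ℝ =>
      (∫ y in Set.Iic x, (h' y : ℂ) * Complex.exp (-(Complex.I * (√(k ^ 2 + c ^ 2) : ℝ) * y)))
        * Complex.exp (Complex.I * k * x)) atTop (𝓝 0) := by
    rw [tendsto_zero_iff_norm_tendsto_zero] at hJ ⊢
    refine hJ.congr fun k => ?_
    rw [norm_mul]
    simp [Complex.norm_exp]
  have hrC := ((Complex.continuous_ofReal.tendsto 1).comp hr).const_mul Complex.I
  have hmain := (hE.add (hrC.mul ((hexp.const_mul (h x : ℂ)).sub hJe))).add_const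
    (Complex.I * ((c ^ 2 * x / 2 - h x : ℝ) : ℂ))
  have hlim : -(Complex.I * (x : ℂ)) * ((c ^ 2 / 2 : ℝ) : ℂ)
      + Complex.I * ((1 : ℝ) : ℂ) * ((h x : ℂ) * 1 - 0)
      + Complex.I * ((c ^ 2 * x / 2 - h x : ℝ) : ℂ) = 0 := by
    push_cast
    ring
  rw [hlim] at hmain
  refine hmain.congr' ?_
  filter_upwards [eventually_gt_atTop 0] with k hk
  have hspos : 0 < √(k ^ 2 + c ^ 2) := Real.sqrt_pos.2 (by positivity)
  have hkC : (k : ℂ) ≠ 0 := by exact_mod_cast hk.ne'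
  rw [hφ₁, ← integral_Iic_eq_integral_Iio,
    integral_Iic_mul_exp_eq x _ hspos.ne' h h' hderiv hint hint']
  have hsplit : Complex.exp (-(Complex.I * x) * ↑(√(k ^ 2 + c ^ 2) - k)) =
      Complex.exp (-(Complex.I * (√(k ^ 2 + c ^ 2) : ℝ) * x)) * Complex.exp (Complex.I * k * x) := by
    rw [← Complex.exp_add]
    congr 1
    push_cast
    ring
  have hinv : ((c ^ 2 * x / 2 - h x : ℝ) : ℂ) / (Complex.I * k) =
      -(Complex.I * ((c ^ 2 * x / 2 - h x : ℝ) : ℂ)) / k := by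
    rw [div_mul_eq_div_div, Complex.div_I, mul_comm]
  rw [hsplit, hinv]
  simp only [Function.comp_apply, Complex.ofReal_div]
  generalize ((c ^ 2 * x / 2 - h x : ℝ) : ℂ) = A
  have hsC : ((√(k ^ 2 + c ^ 2) : ℝ) : ℂ) ≠ 0 := by exact_mod_cast hspos.ne'
  field_simp
  ring
end

section
/- Let x ∈ ℝ, k ∈ ℂ, and let φ, φ₁, T, T₁, R₁ ∈ ℂ with T ≠ 0, satisfying T₁·φ = conj(φ₁) + R₁·φ₁ and R₁ = −T/conj(T). Then the row vectors (T·φ₁·e^{ikx}, φ·e^{−ikx}) and (conj(T)·conj(φ₁)·e^{ikx}, φ·e^{−ikx}) satisfy (T·φ₁·e^{ikx}, φ·e^{−ikx}) = (conj(T)·conj(φ₁)·e^{ikx}, φ·e^{−ikx})·v, where v is the 2×2 matrix with rows (1, 0) and (−T₁·conj(T)·e^{2ikx}, 1). -/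
/-- Derivation of the jump condition across the upper part of the cut: if
`T₁·φ = conj(φ₁) + R₁·φ₁`, `R₁ = −T/conj(T)` and `T ≠ 0`, then
`(Tφ₁e^{ikx}, φe^{−ikx}) = (conj(T)conj(φ₁)e^{ikx}, φe^{−ikx})·v` with the
lower-triangular jump matrix `v = [[1, 0], [−T₁·conj(T)·e^{2ikx}, 1]]`. -/
theorem stmt18 (x : ℝ) (k : ℂ) (φ φ₁ T T₁ R₁ : ℂ) (hT : T ≠ 0)
    (h1 : T₁ * φ = starRingEnd ℂ φ₁ + R₁ * φ₁)
    (h2 : R₁ = -T / starRingEnd ℂ T) :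
    (!![T * φ₁ * Complex.exp (Complex.I * k * x),
        φ * Complex.exp (-(Complex.I * k * x))] : Matrix (Fin 1) (Fin 2) ℂ)
    = !![starRingEnd ℂ T * starRingEnd ℂ φ₁ * Complex.exp (Complex.I * k * x),
         φ * Complex.exp (-(Complex.I * k * x))]
      * !![1, 0; -T₁ * starRingEnd ℂ T * Complex.exp (2 * Complex.I * k * x), 1] := by
  have hT' : starRingEnd ℂ T ≠ 0 := (map_ne_zero _).mpr hT
  have hR : starRingEnd ℂ T * R₁ = -T := by rw [h2, mul_div_cancel₀ _ hT']
  have hexp : Complex.exp (-(Complex.I * k * x)) * Complex.exp (2 * Complex.I * k * x)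
      = Complex.exp (Complex.I * k * x) := by
    rw [← Complex.exp_add]
    ring_nf
  ext i j
  fin_cases i
  fin_cases j
  · simp only [Matrix.mul_apply, Fin.sum_univ_two]
    simp
    linear_combination (T₁ * φ * starRingEnd ℂ T) * hexp
      + starRingEnd ℂ T * Complex.exp (Complex.I * k * x) * h1
      + φ₁ * Complex.exp (Complex.I * k * x) * hR
  · simp [Matrix.mul_apply, Fin.sum_univ_two]
end
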